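/- arXiv:2505.16217 — 8 statements merged into one kernel-verified Lean document; each statement's English description precedes it below -/
import Mathlib

section
/- Let n ≥ 1, let P be an n×n real matrix with nonnegative entries whose row sums are all at most 1, let r̃ > 1 be a real number, and let γ ∈ (0,1). Then the matrices A = r̃·I − P and B = I − γ·P are both invertible, and for every nonzero vector e ∈ ℝⁿ and every real number μ such that A⁻¹ e = μ e, one has μ ≠ 0, γ·(μ⁻¹ − r̃ + γ⁻¹) ≠ 0, and B⁻¹ e = [γ·(μ⁻¹ − r̃ + γ⁻¹)]⁻¹ e. In other words, every eigenvector of the default representation A⁻¹ with eigenvalue μ is an eigenvector of the successor representation B⁻¹ with eigenvalue [γ(μ⁻¹ − r̃ + γ⁻¹)]⁻¹. -/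
open Matrix

theorem aux_unit (n : ℕ) (P : Matrix (Fin n) (Fin n) ℝ)
    (h0 : ∀ i j, 0 ≤ P i j) (h1 : ∀ i, ∑ j, P i j ≤ 1) (c : ℝ) (hc : 1 < c) :
    IsUnit (c • (1 : Matrix (Fin n) (Fin n) ℝ) - P) := by
  rw [Matrix.isUnit_iff_isUnit_det, isUnit_iff_ne_zero]
  apply det_ne_zero_of_sum_row_lt_diag
  intro k
  have e1 : ∑ j ∈ Finset.univ.erase k, ‖(c • (1 : Matrix (Fin n) (Fin n) ℝ) - P) k j‖
      = ∑ j ∈ Finset.univ.erase k, P k j := by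
    apply Finset.sum_congr rfl
    intro j hj
    have hne : k ≠ j := (Finset.ne_of_mem_erase hj).symm
    simp [Matrix.one_apply, hne, abs_of_nonneg (h0 k j)]
  have e2 := Finset.add_sum_erase Finset.univ (fun j => P k j) (Finset.mem_univ k)
  have e3 : (c • (1 : Matrix (Fin n) (Fin n) ℝ) - P) k k = c - P k k := by simp
  rw [e1, e3, Real.norm_eq_abs]
  have := h1 k
  have := le_abs_self (c - P k k)
  linarith

theorem stmt_0 (n : ℕ) (hn : 1 ≤ n) (P : Matrix (Fin n) (Fin n) ℝ)
    (hP_nonneg : ∀ i j, 0 ≤ P i j)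
    (hP_rowsum : ∀ i, ∑ j, P i j ≤ 1)
    (rt γ : ℝ) (hrt : 1 < rt) (hγ0 : 0 < γ) (hγ1 : γ < 1) :
    IsUnit (rt • (1 : Matrix (Fin n) (Fin n) ℝ) - P) ∧
    IsUnit ((1 : Matrix (Fin n) (Fin n) ℝ) - γ • P) ∧
    ∀ (e : Fin n → ℝ), e ≠ 0 → ∀ μ : ℝ,
      (rt • (1 : Matrix (Fin n) (Fin n) ℝ) - P)⁻¹ *ᵥ e = μ • e →
      μ ≠ 0 ∧ γ * (μ⁻¹ - rt + γ⁻¹) ≠ 0 ∧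
      ((1 : Matrix (Fin n) (Fin n) ℝ) - γ • P)⁻¹ *ᵥ e
        = (γ * (μ⁻¹ - rt + γ⁻¹))⁻¹ • e := by
  have hA := aux_unit n P hP_nonneg hP_rowsum rt hrt
  have hB : IsUnit ((1 : Matrix (Fin n) (Fin n) ℝ) - γ • P) := by
    have h := aux_unit n P hP_nonneg hP_rowsum γ⁻¹ ((one_lt_inv₀ hγ0).2 hγ1)
    have e : (1 : Matrix (Fin n) (Fin n) ℝ) - γ • P = γ • (γ⁻¹ • 1 - P) := by
      rw [smul_sub, smul_smul, mul_inv_cancel₀ hγ0.ne', one_smul]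
    rw [e]
    exact h.smul (Units.mk0 γ hγ0.ne')
  refine ⟨hA, hB, ?_⟩
  intro e he μ h
  rw [Matrix.isUnit_iff_isUnit_det] at hA hB
  have h2 : e = μ • (rt • e - P *ᵥ e) := by
    have := congrArg (fun v => (rt • (1 : Matrix (Fin n) (Fin n) ℝ) - P) *ᵥ v) h
    simpa [Matrix.mulVec_mulVec, Matrix.mul_nonsing_inv _ hA, Matrix.mulVec_smul,
      Matrix.sub_mulVec, Matrix.smul_mulVec] using this
  have hμ : μ ≠ 0 := by
    rintro rfl
    exact he (by simpa using h2)
  have h3 : ((1 : Matrix (Fin n) (Fin n) ℝ) - γ • P) *ᵥ e = (γ * (μ⁻¹ - rt + γ⁻¹)) • e := by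
    rw [Matrix.sub_mulVec, Matrix.smul_mulVec, Matrix.one_mulVec]
    ext i
    have := congrFun h2 i
    simp only [Pi.smul_apply, Pi.sub_apply, smul_eq_mul] at this ⊢
    have h4 : μ⁻¹ * e i = rt * e i - (P *ᵥ e) i := by
      rw [inv_mul_eq_iff_eq_mul₀ hμ]; exact this
    have h5 : γ * γ⁻¹ = 1 := mul_inv_cancel₀ hγ0.ne'
    linear_combination (-γ) * h4 - e i * h5
  have h6 : e = (γ * (μ⁻¹ - rt + γ⁻¹)) • (((1 : Matrix (Fin n) (Fin n) ℝ) - γ • P)⁻¹ *ᵥ e) := by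
    rw [← Matrix.mulVec_smul, ← h3, Matrix.mulVec_mulVec, Matrix.nonsing_inv_mul _ hB,
      Matrix.one_mulVec]
  have hc : γ * (μ⁻¹ - rt + γ⁻¹) ≠ 0 := by
    intro h0
    rw [h0, zero_smul] at h6
    exact he h6
  refine ⟨hμ, hc, ?_⟩
  rw [eq_inv_smul_iff₀ hc]
  exact h6.symm
end

section
/- Let S be a finite state set, T ⊆ S a set of terminal states, r : S → ℝ a reward function with r(s) < 0 for every s ∉ T, and λ > 0. Let P be the |S|×|S| real matrix with nonnegative entries such that the row of P indexed by any s ∈ T is identically zero and the row indexed by any s ∉ T sums to 1. Let R be the diagonal matrix with diagonal entries exp(−r(s)/λ). Define the sequence of matrices Z₀ = R⁻¹ and Z_{k+1} = R⁻¹ + R⁻¹ P Z_k. Then R − P is invertible and the sequence (Z_k) converges (entrywise, equivalently in any matrix norm) to (R − P)⁻¹ as k → ∞. -/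
open Matrix Filter

attribute [local instance] Matrix.linftyOpNormedRing Matrix.linftyOpNormedAddCommGroup

theorem aux_norm_lt {S : Type*} [Fintype S] [DecidableEq S] (A : Matrix S S ℝ)
    (h0 : ∀ i j, 0 ≤ A i j) (h : ∀ i, ∑ j, A i j < 1) : ‖A‖ < 1 := by
  rw [← coe_nnnorm, Matrix.linfty_opNNNorm_def, ← NNReal.coe_one, NNReal.coe_lt_coe,
    Finset.sup_lt_iff (by simp)]
  intro i _
  rw [← NNReal.coe_lt_coe]
  push_cast
  simpa [abs_of_nonneg (h0 i _)] using h i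

theorem aux_pow {S : Type*} [Fintype S] [DecidableEq S] (A : Matrix S S ℝ)
    (h : ‖A‖ < 1) : IsUnit (1 - A) ∧ Tendsto (fun k : ℕ => A ^ k) atTop (nhds 0) :=
  haveI : @CompleteSpace (Matrix S S ℝ)
      (Matrix.linftyOpNormedRing (n := S) (α := ℝ)).toMetricSpace.toPseudoMetricSpace.toUniformSpace :=
    (inferInstance : CompleteSpace (S → S → ℝ))
  ⟨isUnit_one_sub_of_norm_lt_one h, tendsto_pow_atTop_nhds_zero_of_norm_lt_one h⟩

theorem stmt_2 (S : Type*) [Fintype S] [DecidableEq S]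
    (T : Set S) (r : S → ℝ) (lam : ℝ) (hlam : 0 < lam)
    (hr : ∀ s, s ∉ T → r s < 0)
    (P : Matrix S S ℝ)
    (hP_nonneg : ∀ s s', 0 ≤ P s s')
    (hP_term : ∀ s ∈ T, ∀ s', P s s' = 0)
    (hP_nonterm : ∀ s, s ∉ T → ∑ s', P s s' = 1)
    (R : Matrix S S ℝ) (hR : R = Matrix.diagonal (fun s => Real.exp (-r s / lam)))
    (Z : ℕ → Matrix S S ℝ)
    (hZ0 : Z 0 = R⁻¹)
    (hZsucc : ∀ k, Z (k + 1) = R⁻¹ + R⁻¹ * P * Z k) :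
    IsUnit (R - P) ∧ Tendsto Z atTop (nhds (R - P)⁻¹) := by
  have hmul : R * Matrix.diagonal (fun s => Real.exp (r s / lam)) = 1 := by
    rw [hR, Matrix.diagonal_mul_diagonal, ← Matrix.diagonal_one]
    congr 1
    funext s
    rw [← Real.exp_add, neg_div, neg_add_cancel, Real.exp_zero]
  have hinv : R⁻¹ = Matrix.diagonal (fun s => Real.exp (r s / lam)) := Matrix.inv_eq_right_inv hmul
  have hRR : R * R⁻¹ = 1 := by rw [hinv, hmul]
  have hRR' : R⁻¹ * R = 1 := mul_eq_one_comm.mp hRR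
  have hUR : IsUnit R := IsUnit.of_mul_eq_one _ hRR
  have hent : ∀ i j, (R⁻¹ * P) i j = Real.exp (r i / lam) * P i j := by
    intro i j
    rw [hinv, Matrix.diagonal_mul]
  obtain ⟨A, hA⟩ : ∃ A, A = R⁻¹ * P := ⟨_, rfl⟩
  have hlt : ‖A‖ < 1 := by
    rw [hA]
    apply aux_norm_lt
    · intro i j
      rw [hent]
      exact mul_nonneg (Real.exp_pos _).le (hP_nonneg i j)
    · intro i
      simp only [hent]
      rw [← Finset.mul_sum]
      by_cases hi : i ∈ T
      · simp [hP_term i hi]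
      · rw [hP_nonterm i hi, mul_one, Real.exp_lt_one_iff]
        exact div_neg_of_neg_of_pos (hr i hi) hlam
  obtain ⟨hU, hT⟩ := aux_pow A hlt
  have hfac : R - P = R * (1 - A) := by
    rw [hA, mul_sub, mul_one, ← mul_assoc, hRR, one_mul]
  have hunit : IsUnit (R - P) := hfac ▸ hUR.mul hU
  refine ⟨hunit, ?_⟩
  obtain ⟨W, hW⟩ : ∃ W, W = (R - P)⁻¹ := ⟨_, rfl⟩
  have hW1 : (R - P) * W = 1 := by
    rw [hW]
    exact Matrix.mul_nonsing_inv _ ((Matrix.isUnit_iff_isUnit_det _).mp hunit)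
  have hW2 : W = R⁻¹ + A * W := by
    have : R⁻¹ * ((R - P) * W) = R⁻¹ := by rw [hW1, mul_one]
    rw [← mul_assoc, mul_sub, hRR', ← hA, sub_mul, one_mul] at this
    rw [← this, sub_add_cancel]
  have hE : ∀ k, Z k = W + A ^ k * (Z 0 - W) := by
    intro k
    induction k with
    | zero => simp
    | succ k ih =>
      rw [hZsucc, ← hA, ih, mul_add, ← add_assoc, ← hW2, pow_succ', mul_assoc]
  rw [← hW]
  have hlim : Tendsto (fun k => W + A ^ k * (Z 0 - W)) atTop (nhds (W + 0 * (Z 0 - W))) :=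
    tendsto_const_nhds.add (hT.mul tendsto_const_nhds)
  rw [zero_mul, add_zero] at hlim
  exact hlim.congr (fun k => (hE k).symm)
end

section
/- Let n ≥ 1 and let M be a symmetric n×n real matrix with nonnegative entries such that some row of M (say the row with index i₀) has all entries strictly positive. Then there exist a real number μ > 0 and a vector v ∈ ℝⁿ with all entries strictly positive such that M v = μ v, and moreover every real eigenvalue ν of M satisfies ν ≤ μ; that is, the largest eigenvalue of M is positive and admits an entrywise positive eigenvector. -/
open Matrix

theorem stmt_3 (n : ℕ) (hn : 1 ≤ n) (M : Matrix (Fin n) (Fin n) ℝ)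
    (hM_symm : M.IsSymm)
    (hM_nonneg : ∀ i j, 0 ≤ M i j)
    (i₀ : Fin n) (hrow_pos : ∀ j, 0 < M i₀ j) :
    ∃ (μ : ℝ) (v : Fin n → ℝ), 0 < μ ∧ (∀ i, 0 < v i) ∧ M *ᵥ v = μ • v ∧
      ∀ ν : ℝ, ¬ IsUnit (M - ν • (1 : Matrix (Fin n) (Fin n) ℝ)) → ν ≤ μ := by
  have hcomp : IsCompact {x : Fin n → ℝ | x ⬝ᵥ x = 1} := by
    refine (isCompact_Icc (a := fun _ : Fin n => (-1 : ℝ)) (b := fun _ => 1)).of_isClosed_subset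
      (isClosed_eq (by unfold dotProduct; fun_prop) continuous_const) ?_
    intro x hx
    have h : ∀ i, x i * x i ≤ 1 := fun i => by
      rw [← show x ⬝ᵥ x = 1 from hx]
      exact Finset.single_le_sum (f := fun i => x i * x i) (fun j _ => mul_self_nonneg (x j))
        (Finset.mem_univ i)
    exact ⟨fun i => by have := h i; simp only; nlinarith,
      fun i => by have := h i; simp only; nlinarith⟩
  have hne : ({x : Fin n → ℝ | x ⬝ᵥ x = 1}).Nonempty := ⟨Pi.single i₀ 1, by simp⟩
  obtain ⟨x, hx, hmax⟩ := hcomp.exists_isMaxOn hne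
    (f := fun x => x ⬝ᵥ (M *ᵥ x)) (by unfold mulVec dotProduct; fun_prop)
  have hx1 : x ⬝ᵥ x = 1 := hx
  set w : Fin n → ℝ := fun i => |x i| with hw
  have hww : w ⬝ᵥ w = 1 := by
    rw [← hx1]; simp [dotProduct, hw]
  have hxw : x ⬝ᵥ (M *ᵥ x) ≤ w ⬝ᵥ (M *ᵥ w) := by
    simp only [dotProduct, mulVec, Finset.mul_sum]
    refine Finset.sum_le_sum fun i _ => Finset.sum_le_sum fun j _ => ?_
    calc x i * (M i j * x j) ≤ |x i * (M i j * x j)| := le_abs_self _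
      _ = w i * (M i j * w j) := by rw [abs_mul, abs_mul, abs_of_nonneg (hM_nonneg i j)]
  set μ := w ⬝ᵥ (M *ᵥ w) with hμ
  have hS : ∀ y : Fin n → ℝ, y ⬝ᵥ y = 1 → y ⬝ᵥ (M *ᵥ y) ≤ μ := fun y hy =>
    (hmax (show y ∈ {x : Fin n → ℝ | x ⬝ᵥ x = 1} from hy)).trans hxw
  have hpos : ∀ y : Fin n → ℝ, y ≠ 0 → 0 < y ⬝ᵥ y := fun y hy => by
    refine lt_of_le_of_ne (Finset.sum_nonneg fun i _ => mul_self_nonneg (y i)) ?_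
    intro h
    exact hy (dotProduct_self_eq_zero.1 h.symm)
  have hQ : ∀ y : Fin n → ℝ, y ⬝ᵥ (M *ᵥ y) ≤ μ * (y ⬝ᵥ y) := by
    intro y
    by_cases hy : y = 0
    · simp [hy]
    have hp := hpos y hy
    have hs : Real.sqrt (y ⬝ᵥ y) * Real.sqrt (y ⬝ᵥ y) = y ⬝ᵥ y := Real.mul_self_sqrt hp.le
    have hs0 : 0 < Real.sqrt (y ⬝ᵥ y) := Real.sqrt_pos.2 hp
    set s := Real.sqrt (y ⬝ᵥ y)
    have h := hS (s⁻¹ • y) (by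
      simp only [smul_dotProduct, dotProduct_smul, smul_eq_mul]
      rw [← hs]; field_simp)
    simp only [mulVec_smul, smul_dotProduct, dotProduct_smul, smul_eq_mul] at h
    rw [← hs]
    have h2 := mul_le_mul_of_nonneg_right h (mul_self_nonneg s)
    calc _ = s⁻¹ * (s⁻¹ * y ⬝ᵥ (M *ᵥ y)) * (s * s) := by field_simp
      _ ≤ _ := h2
  have hpsd : (μ • (1 : Matrix (Fin n) (Fin n) ℝ) - M).PosSemidef := by
    refine PosSemidef.of_dotProduct_mulVec_nonneg ?_ ?_
    · rw [IsHermitian, conjTranspose_eq_transpose_of_trivial]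
      simp [hM_symm.eq]
    · intro y
      have := hQ y
      simp only [star_trivial, sub_mulVec, smul_mulVec, one_mulVec, dotProduct_sub,
        dotProduct_smul, smul_eq_mul]
      linarith
  have heig : M *ᵥ w = μ • w := by
    have := (hpsd.dotProduct_mulVec_zero_iff w).1 (by
      simp only [star_trivial, sub_mulVec, smul_mulVec, one_mulVec, dotProduct_sub,
        dotProduct_smul, smul_eq_mul, hww]
      linarith)
    simp only [sub_mulVec, smul_mulVec, one_mulVec] at this
    exact (sub_eq_zero.1 this).symm
  have hμ0 : 0 < μ := by
    have := hS (Pi.single i₀ 1) (by simp)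
    simp at this
    exact (hrow_pos i₀).trans_le this
  have hw0 : ∀ i, 0 ≤ w i := fun i => abs_nonneg _
  have hle : ∀ i j, M i j * w j ≤ μ * w i := fun i j => by
    have h := congrFun heig i
    simp only [Pi.smul_apply, smul_eq_mul] at h
    rw [← h]
    exact Finset.single_le_sum (f := fun j => M i j * w j)
      (fun j _ => mul_nonneg (hM_nonneg i j) (hw0 j)) (Finset.mem_univ j)
  have hex : ∃ j, 0 < w j := by
    by_contra! hcon
    have : w = 0 := funext fun j => le_antisymm (hcon j) (hw0 j)
    rw [this] at hww
    simp at hww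
  obtain ⟨j, hj⟩ := hex
  have hi0 : 0 < w i₀ :=
    pos_of_mul_pos_right ((mul_pos (hrow_pos j) hj).trans_le (hle i₀ j)) hμ0.le
  refine ⟨μ, w, hμ0, fun i => ?_, heig, ?_⟩
  · have : 0 < M i i₀ := by rw [← hM_symm.apply]; exact hrow_pos i
    exact pos_of_mul_pos_right ((mul_pos this hi0).trans_le (hle i i₀)) hμ0.le
  · intro ν hν
    rw [isUnit_iff_isUnit_det, isUnit_iff_ne_zero, not_not] at hν
    obtain ⟨v, hv, hv0⟩ := exists_mulVec_eq_zero_iff.2 hν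
    simp only [sub_mulVec, smul_mulVec, one_mulVec] at hv0
    have h := hQ v
    rw [sub_eq_zero.1 hv0, dotProduct_smul, smul_eq_mul] at h
    exact le_of_mul_le_mul_right h (hpos v hv)
end

section
/- Let S be a finite state set with a nonempty set of non-terminal states S \ T, let r : S → ℝ satisfy r(s) < 0 for every s ∉ T, and let λ > 0. Let P be the |S|×|S| real matrix with nonnegative entries whose rows indexed by s ∈ T are identically zero and whose rows indexed by s ∉ T sum to 1, and let R be the diagonal matrix with diagonal entries exp(−r(s)/λ). Then the maximum over all rows s of the absolute row sum Σ_j |(R⁻¹P)(s,j)| (i.e., the ℓ∞ operator norm of R⁻¹P) equals max_{s ∉ T} exp(r(s)/λ), and this quantity is strictly less than 1. -/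
open Matrix

theorem stmt_8 (S : Type*) [Fintype S] [DecidableEq S]
    (T : Finset S) (hT : (Tᶜ : Finset S).Nonempty)
    (hS : (Finset.univ : Finset S).Nonempty)
    (r : S → ℝ) (lam : ℝ) (hlam : 0 < lam)
    (hr : ∀ s, s ∉ T → r s < 0)
    (P : Matrix S S ℝ)
    (hP_nonneg : ∀ s s', 0 ≤ P s s')
    (hP_term : ∀ s ∈ T, ∀ s', P s s' = 0)
    (hP_nonterm : ∀ s, s ∉ T → ∑ s', P s s' = 1)
    (R : Matrix S S ℝ) (hR : R = Matrix.diagonal (fun s => Real.exp (-r s / lam))) :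
    Finset.univ.sup' hS (fun s => ∑ j, |(R⁻¹ * P) s j|)
      = (Tᶜ : Finset S).sup' hT (fun s => Real.exp (r s / lam)) ∧
    Finset.univ.sup' hS (fun s => ∑ j, |(R⁻¹ * P) s j|) < 1 := by
  have hinv : R⁻¹ = Matrix.diagonal (fun s => Real.exp (r s / lam)) := by
    apply Matrix.inv_eq_left_inv
    rw [hR, Matrix.diagonal_mul_diagonal, ← Matrix.diagonal_one]
    congr 1
    funext s
    rw [← Real.exp_add, neg_div, add_neg_cancel, Real.exp_zero]
  have hrow : ∀ s, ∑ j, |(R⁻¹ * P) s j| = Real.exp (r s / lam) * ∑ j, P s j := by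
    intro s
    rw [hinv, Finset.mul_sum]
    refine Finset.sum_congr rfl fun j _ => ?_
    rw [Matrix.diagonal_mul, abs_of_nonneg (mul_nonneg (Real.exp_pos _).le (hP_nonneg s j))]
  have hn : ∀ s, s ∉ T → ∑ j, |(R⁻¹ * P) s j| = Real.exp (r s / lam) := by
    intro s hs
    rw [hrow, hP_nonterm s hs, mul_one]
  have ht : ∀ s, s ∈ T → ∑ j, |(R⁻¹ * P) s j| = 0 := by
    intro s hs
    rw [hrow, Finset.sum_eq_zero (fun j _ => hP_term s hs j), mul_zero]
  constructor
  · apply le_antisymm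
    · refine Finset.sup'_le _ _ fun s _ => ?_
      by_cases hs : s ∈ T
      · rw [ht s hs]
        obtain ⟨t, h⟩ := hT
        exact (Real.exp_pos (r t / lam)).le.trans
          (Finset.le_sup' (fun s => Real.exp (r s / lam)) h)
      · rw [hn s hs]
        exact Finset.le_sup' (fun s => Real.exp (r s / lam)) (Finset.mem_compl.2 hs)
    · refine Finset.sup'_le _ _ fun s h => ?_
      rw [← hn s (Finset.mem_compl.1 h)]
      exact Finset.le_sup' (fun s => ∑ j, |(R⁻¹ * P) s j|) (Finset.mem_univ s)
  · rw [Finset.sup'_lt_iff]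
    intro s _
    by_cases hs : s ∈ T
    · rw [ht s hs]
      exact one_pos
    · rw [hn s hs, Real.exp_lt_one_iff]
      exact div_neg_of_neg_of_pos (hr s hs) hlam
end

section
/- Let S be a finite state set, T ⊆ S a set of terminal states, r : S → ℝ with r(s) < 0 for every s ∉ T, and λ > 0. Let P be the |S|×|S| real matrix with nonnegative entries whose rows indexed by s ∈ T are identically zero and whose rows indexed by s ∉ T sum to 1, and let R = diag(exp(−r(s)/λ)). Then the series Σ_{t=0}^∞ (R⁻¹P)ᵗ R⁻¹ is summable, R − P is invertible, and (R − P)⁻¹ = Σ_{t=0}^∞ (R⁻¹P)ᵗ R⁻¹. -/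
open Matrix

section aux
attribute [local instance] Matrix.linftyOpNormedRing Matrix.linftyOpNormedAlgebra

theorem aux_geom {S : Type*} [Fintype S] [DecidableEq S] (A : Matrix S S ℝ)
    (h : ∀ i, ∑ j, |A i j| < 1) :
    Summable (fun t : ℕ => A ^ t) ∧ (1 - A) * (∑' t : ℕ, A ^ t) = 1 := by
  have hn : ‖A‖ < 1 := by
    rw [← coe_nnnorm, Matrix.linfty_opNNNorm_def, ← NNReal.coe_one, NNReal.coe_lt_coe,
      Finset.sup_lt_iff (by simp)]
    intro i _
    rw [← NNReal.coe_lt_coe]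
    simpa using h i
  haveI : CompleteSpace (Matrix S S ℝ) := FiniteDimensional.complete ℝ _
  exact ⟨summable_geometric_of_norm_lt_one hn, mul_neg_geom_series A hn⟩
end aux

theorem stmt_9 (S : Type*) [Fintype S] [DecidableEq S]
    (T : Set S) (r : S → ℝ) (lam : ℝ) (hlam : 0 < lam)
    (hr : ∀ s, s ∉ T → r s < 0)
    (P : Matrix S S ℝ)
    (hP_nonneg : ∀ s s', 0 ≤ P s s')
    (hP_term : ∀ s ∈ T, ∀ s', P s s' = 0)
    (hP_nonterm : ∀ s, s ∉ T → ∑ s', P s s' = 1)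
    (R : Matrix S S ℝ) (hR : R = Matrix.diagonal (fun s => Real.exp (-r s / lam))) :
    Summable (fun t : ℕ => (R⁻¹ * P) ^ t * R⁻¹) ∧
    IsUnit (R - P) ∧
    (R - P)⁻¹ = ∑' t : ℕ, (R⁻¹ * P) ^ t * R⁻¹ := by
  have hmul : R * Matrix.diagonal (fun s => Real.exp (r s / lam)) = 1 := by
    rw [hR, Matrix.diagonal_mul_diagonal, ← Matrix.diagonal_one]
    congr 1
    ext s
    rw [← Real.exp_add, neg_div, neg_add_cancel, Real.exp_zero]
  have hinv : R⁻¹ = Matrix.diagonal (fun s => Real.exp (r s / lam)) :=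
    Matrix.inv_eq_right_inv hmul
  have hRR : R * R⁻¹ = 1 := by rw [hinv]; exact hmul
  have hA : ∀ i, ∑ j, |(R⁻¹ * P) i j| < 1 := by
    intro i
    have e : ∀ j, |(R⁻¹ * P) i j| = Real.exp (r i / lam) * P i j := by
      intro j
      rw [hinv, Matrix.diagonal_mul, abs_of_nonneg (mul_nonneg (Real.exp_pos _).le (hP_nonneg i j))]
    simp only [e]
    rw [← Finset.mul_sum]
    by_cases hi : i ∈ T
    · simp [hP_term i hi]
    · rw [hP_nonterm i hi, mul_one, Real.exp_lt_one_iff]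
      exact div_neg_of_neg_of_pos (hr i hi) hlam
  obtain ⟨hs, hg⟩ := aux_geom (R⁻¹ * P) hA
  have hfac : R - P = R * (1 - R⁻¹ * P) := by
    rw [mul_sub, mul_one, ← mul_assoc, hRR, one_mul]
  have hone : (R - P) * (∑' t : ℕ, (R⁻¹ * P) ^ t * R⁻¹) = 1 := by
    rw [hs.tsum_mul_right, hfac, mul_assoc, ← mul_assoc (1 - R⁻¹ * P), hg, one_mul, hRR]
  exact ⟨hs.mul_right _, IsUnit.of_mul_eq_one _ hone, Matrix.inv_eq_right_inv hone⟩
end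

section
/- Let S be a finite state set, T ⊆ S a set of terminal states, r : S → ℝ with r(s) < 0 for every s ∉ T, and λ > 0. Let P be the |S|×|S| real matrix with nonnegative entries whose rows indexed by s ∈ T are identically zero and whose rows indexed by s ∉ T sum to 1, and let R = diag(exp(−r(s)/λ)). Then R − P is invertible, and the matrix Z = (R − P)⁻¹ satisfies, for all states s and j, the entrywise Bellman-type identity Z(s, j) = exp(r(s)/λ)·( 𝟙{s = j} + Σ_{s'} P(s, s')·Z(s', j) ). -/
open Matrix

theorem stmt_11 (S : Type*) [Fintype S] [DecidableEq S]
    (T : Set S) (r : S → ℝ) (lam : ℝ) (hlam : 0 < lam)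
    (hr : ∀ s, s ∉ T → r s < 0)
    (P : Matrix S S ℝ)
    (hP_nonneg : ∀ s s', 0 ≤ P s s')
    (hP_term : ∀ s ∈ T, ∀ s', P s s' = 0)
    (hP_nonterm : ∀ s, s ∉ T → ∑ s', P s s' = 1)
    (R : Matrix S S ℝ) (hR : R = Matrix.diagonal (fun s => Real.exp (-r s / lam))) :
    IsUnit (R - P) ∧
    ∀ s j, (R - P)⁻¹ s j
      = Real.exp (r s / lam) *
        ((if s = j then (1 : ℝ) else 0) + ∑ s', P s s' * (R - P)⁻¹ s' j) := by
  have hsum : ∀ k, ∑ s', P k s' < Real.exp (-r k / lam) := by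
    intro k
    by_cases hk : k ∈ T
    · rw [Finset.sum_eq_zero (fun j _ => hP_term k hk j)]
      exact Real.exp_pos _
    · rw [hP_nonterm k hk]
      exact Real.one_lt_exp_iff.mpr (div_pos (neg_pos.mpr (hr k hk)) hlam)
  have hdet : (R - P).det ≠ 0 := by
    apply det_ne_zero_of_sum_row_lt_diag
    intro k
    have h1 : ∑ j ∈ Finset.univ.erase k, ‖(R - P) k j‖ = ∑ j ∈ Finset.univ.erase k, P k j := by
      apply Finset.sum_congr rfl
      intro j hj
      have hne : k ≠ j := (Finset.ne_of_mem_erase hj).symm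
      simp [hR, Matrix.diagonal_apply_ne _ hne, abs_of_nonneg (hP_nonneg k j)]
    have h2 := Finset.add_sum_erase Finset.univ (fun j => P k j) (Finset.mem_univ k)
    have h3 : (R - P) k k = Real.exp (-r k / lam) - P k k := by
      simp [hR]
    have h4 := hsum k
    rw [h1, h3, Real.norm_eq_abs]
    refine lt_of_lt_of_le ?_ (le_abs_self _)
    linarith
  have hu : IsUnit (R - P).det := isUnit_iff_ne_zero.mpr hdet
  refine ⟨(Matrix.isUnit_iff_isUnit_det _).mpr hu, ?_⟩
  intro s j
  have h := congrFun (congrFun (Matrix.mul_nonsing_inv (R - P) hu) s) j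
  generalize (R - P)⁻¹ = Z at h ⊢
  rw [Matrix.sub_mul, Matrix.sub_apply, hR, Matrix.diagonal_mul, Matrix.mul_apply,
    Matrix.one_apply] at h
  rw [← h, sub_add_cancel, ← mul_assoc, ← Real.exp_add]
  have : r s / lam + -r s / lam = 0 := by ring
  rw [this, Real.exp_zero, one_mul]
end

section
/- Let S be a finite state set, T ⊆ S a set of terminal states, r : S → ℝ with r(s) < 0 for every s ∉ T, and λ > 0. Let P be the |S|×|S| real matrix with nonnegative entries whose rows indexed by s ∈ T are identically zero and whose rows indexed by s ∉ T sum to 1, and let R = diag(exp(−r(s)/λ)). Then R − P is invertible, every entry of Z = (R − P)⁻¹ is nonnegative, and every diagonal entry of Z is strictly positive. -/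
open Matrix

theorem min_principle_aux {S : Type*} [Fintype S] (d : S → ℝ) (P : Matrix S S ℝ)
    (hP : ∀ s s', 0 ≤ P s s') (hd : ∀ s, ∑ s', P s s' < d s) (x : S → ℝ)
    (hx : ∀ s, 0 ≤ d s * x s - ∑ s', P s s' * x s') : ∀ s, 0 ≤ x s := by
  intro t
  haveI : Nonempty S := ⟨t⟩
  obtain ⟨m, hm⟩ := Finite.exists_min x
  refine le_trans ?_ (hm t)
  by_contra! hneg
  have h1 : (∑ s', P m s') * x m ≤ ∑ s', P m s' * x s' := by
    rw [Finset.sum_mul]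
    exact Finset.sum_le_sum fun i _ => mul_le_mul_of_nonneg_left (hm i) (hP m i)
  have h2 := hx m
  have h3 := hd m
  nlinarith

theorem stmt_13 (S : Type*) [Fintype S] [DecidableEq S]
    (T : Set S) (r : S → ℝ) (lam : ℝ) (hlam : 0 < lam)
    (hr : ∀ s, s ∉ T → r s < 0)
    (P : Matrix S S ℝ)
    (hP_nonneg : ∀ s s', 0 ≤ P s s')
    (hP_term : ∀ s ∈ T, ∀ s', P s s' = 0)
    (hP_nonterm : ∀ s, s ∉ T → ∑ s', P s s' = 1)
    (R : Matrix S S ℝ) (hR : R = Matrix.diagonal (fun s => Real.exp (-r s / lam))) :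
    IsUnit (R - P) ∧
    (∀ s s', 0 ≤ (R - P)⁻¹ s s') ∧
    (∀ s, 0 < (R - P)⁻¹ s s) := by
  have hd : ∀ s, ∑ s', P s s' < Real.exp (-r s / lam) := by
    intro s
    by_cases hs : s ∈ T
    · simp [hP_term s hs, Real.exp_pos]
    · rw [hP_nonterm s hs]
      exact Real.one_lt_exp_iff.mpr (div_pos (neg_pos.mpr (hr s hs)) hlam)
  have hmv : ∀ x : S → ℝ, ∀ s, ((R - P) *ᵥ x) s =
      Real.exp (-r s / lam) * x s - ∑ s', P s s' * x s' := by
    intro x s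
    rw [hR, Matrix.sub_mulVec, Pi.sub_apply, Matrix.mulVec_diagonal]
    rfl
  have hmin : ∀ x : S → ℝ, (∀ s, 0 ≤ ((R - P) *ᵥ x) s) → ∀ s, 0 ≤ x s := by
    intro x hx
    exact min_principle_aux _ P hP_nonneg hd x fun s => by rw [← hmv]; exact hx s
  have hU : IsUnit (R - P) := by
    rw [← Matrix.mulVec_injective_iff_isUnit]
    intro x y hxy
    have hxy' : (R - P) *ᵥ x = (R - P) *ᵥ y := hxy
    funext s
    have h1 := hmin (x - y) (by intro s; rw [Matrix.mulVec_sub, hxy']; simp) s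
    have h2 := hmin (y - x) (by intro s; rw [Matrix.mulVec_sub, hxy']; simp) s
    simp only [Pi.sub_apply] at h1 h2
    linarith
  have hmul : (R - P) * (R - P)⁻¹ = 1 :=
    Matrix.mul_nonsing_inv _ ((Matrix.isUnit_iff_isUnit_det _).mp hU)
  have hcol : ∀ s t, ((R - P) *ᵥ (fun i => (R - P)⁻¹ i t)) s = (1 : Matrix S S ℝ) s t := by
    intro s t
    rw [← hmul]
    rfl
  have hnn : ∀ s s', 0 ≤ (R - P)⁻¹ s s' := by
    intro s t
    refine hmin (fun i => (R - P)⁻¹ i t) ?_ s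
    intro i
    rw [hcol, Matrix.one_apply]
    split_ifs <;> norm_num
  refine ⟨hU, hnn, fun s => ?_⟩
  have h := hcol s s
  rw [hmv, Matrix.one_apply_eq] at h
  have h2 : 0 ≤ ∑ i, P s i * (R - P)⁻¹ i s :=
    Finset.sum_nonneg fun i _ => mul_nonneg (hP_nonneg s i) (hnn i s)
  have h3 : 0 < Real.exp (-r s / lam) * (R - P)⁻¹ s s := by linarith
  exact pos_of_mul_pos_right h3 (Real.exp_pos _).le
end

section
/- Let S be a finite state set, T ⊆ S a set of terminal states, r : S → ℝ with r(s) < 0 for every s ∉ T, and λ > 0. Let P be the |S|×|S| real matrix with nonnegative entries whose rows indexed by s ∈ T are identically zero and whose rows indexed by s ∉ T sum to 1, and let R = diag(exp(−r(s)/λ)). Suppose there is a distinguished start state s₀ such that every state is reachable from s₀ under P, i.e., for every state s there exists t ≥ 0 with (Pᵗ)(s₀, s) > 0. Then every entry of the row of Z = (R − P)⁻¹ indexed by s₀ is strictly positive: Z(s₀, s) > 0 for all s ∈ S. -/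
open Matrix

theorem stmt_14 (S : Type*) [Fintype S] [DecidableEq S]
    (T : Set S) (r : S → ℝ) (lam : ℝ) (hlam : 0 < lam)
    (hr : ∀ s, s ∉ T → r s < 0)
    (P : Matrix S S ℝ)
    (hP_nonneg : ∀ s s', 0 ≤ P s s')
    (hP_term : ∀ s ∈ T, ∀ s', P s s' = 0)
    (hP_nonterm : ∀ s, s ∉ T → ∑ s', P s s' = 1)
    (R : Matrix S S ℝ) (hR : R = Matrix.diagonal (fun s => Real.exp (-r s / lam)))
    (s₀ : S) (hreach : ∀ s : S, ∃ t : ℕ, 0 < (P ^ t) s₀ s) :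
    ∀ s : S, 0 < (R - P)⁻¹ s₀ s := by
  subst hR
  set d : S → ℝ := fun s => Real.exp (-r s / lam) with hd
  have hdpos : ∀ s, 0 < d s := fun s => Real.exp_pos _
  have hdom : ∀ i, ∑ j, P i j < d i := by
    intro i
    by_cases hi : i ∈ T
    · rw [Finset.sum_eq_zero (fun j _ => hP_term i hi j)]
      exact hdpos i
    · rw [hP_nonterm i hi]
      apply Real.one_lt_exp_iff.mpr
      exact div_pos (neg_pos.mpr (hr i hi)) hlam
  have hdet : (Matrix.diagonal d - P).det ≠ 0 := by
    apply det_ne_zero_of_sum_row_lt_diag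
    intro k
    have h1 : ∑ j ∈ Finset.univ.erase k, ‖(Matrix.diagonal d - P) k j‖
        = ∑ j ∈ Finset.univ.erase k, P k j := by
      apply Finset.sum_congr rfl
      intro j hj
      have hjk : k ≠ j := (Finset.ne_of_mem_erase hj).symm
      simp [Matrix.diagonal_apply_ne _ hjk, abs_of_nonneg (hP_nonneg k j)]
    have h2 := Finset.add_sum_erase Finset.univ (fun j => P k j) (Finset.mem_univ k)
    have h3 := hdom k
    rw [h1]
    refine lt_of_lt_of_le ?_ (Real.le_norm_self _)
    simp only [Matrix.sub_apply, Matrix.diagonal_apply_eq]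
    linarith
  intro s
  have hmul : (Matrix.diagonal d - P) * (Matrix.diagonal d - P)⁻¹ = 1 :=
    Matrix.mul_nonsing_inv _ (isUnit_iff_ne_zero.mpr hdet)
  set Z := (Matrix.diagonal d - P)⁻¹ with hZ
  have heq : ∀ i, d i * Z i s = ∑ j, P i j * Z j s + (1 : Matrix S S ℝ) i s := by
    intro i
    have h := congrFun (congrFun hmul i) s
    rw [Matrix.sub_mul, Matrix.sub_apply, Matrix.diagonal_mul, Matrix.mul_apply] at h
    linarith
  have hone : ∀ i, 0 ≤ (1 : Matrix S S ℝ) i s := by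
    intro i
    rw [Matrix.one_apply]
    split_ifs <;> norm_num
  have hnn : ∀ i, 0 ≤ Z i s := by
    obtain ⟨m, -, hm⟩ := Finset.exists_min_image Finset.univ (fun i => Z i s) ⟨s, Finset.mem_univ s⟩
    have hm0 : 0 ≤ Z m s := by
      by_contra! hneg
      have h1 : (∑ j, P m j) * Z m s ≤ ∑ j, P m j * Z j s := by
        rw [Finset.sum_mul]
        exact Finset.sum_le_sum fun j _ =>
          mul_le_mul_of_nonneg_left (hm j (Finset.mem_univ j)) (hP_nonneg m j)
      have h2 := mul_lt_mul_of_neg_right (hdom m) hneg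
      have h3 := heq m
      have h4 := hone m
      linarith
    exact fun i => hm0.trans (hm i (Finset.mem_univ i))
  have key : ∀ t : ℕ, ∀ i, 0 < (P ^ t) i s → 0 < Z i s := by
    intro t
    induction t with
    | zero =>
      intro i hi
      rw [pow_zero] at hi
      have h1 : 0 ≤ ∑ j, P i j * Z j s :=
        Finset.sum_nonneg fun j _ => mul_nonneg (hP_nonneg i j) (hnn j)
      have h2 : 0 < d i * Z i s := by rw [heq i]; linarith
      exact (mul_pos_iff_of_pos_left (hdpos i)).mp h2
    | succ t ih =>
      intro i hi
      rw [pow_succ', Matrix.mul_apply] at hi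
      obtain ⟨j, -, hj⟩ := Finset.exists_lt_of_sum_lt
        (s := Finset.univ) (f := fun _ : S => (0 : ℝ)) (by simpa using hi)
      have hPj : 0 < P i j := by
        rcases (hP_nonneg i j).lt_or_eq with h | h
        · exact h
        · simp [← h] at hj
      have hZj := ih j ((mul_pos_iff_of_pos_left hPj).mp hj)
      have h1 : 0 < ∑ j, P i j * Z j s :=
        Finset.sum_pos' (fun j _ => mul_nonneg (hP_nonneg i j) (hnn j))
          ⟨j, Finset.mem_univ j, mul_pos hPj hZj⟩
      have h2 : 0 < d i * Z i s := by rw [heq i]; linarith [hone i]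
      exact (mul_pos_iff_of_pos_left (hdpos i)).mp h2
  obtain ⟨t, ht⟩ := hreach s
  exact key t s₀ ht
end
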